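/- For a classical channel (one whose output is diagonal in a fixed basis and depends only on the diagonal of the input), the one-shot dynamic capacity region is exactly the set of triples (C, Q, E) with C + 2Q ≤ C_cl, Q + E ≤ 0, and C + Q + E ≤ C_cl, where C_cl is the Shannon classical capacity of the channel; in particular the region permits no net quantum communication, i.e. Q + E ≤ 0. -/

import Mathlib

open Matrix
open scoped Classical ComplexOrder

/-- The von Neumann entropy `S(σ) = −Tr(σ log σ)`, computed via the eigenvalues
of a Hermitian matrix (junk value `0` on non-Hermitian matrices). -/
noncomputable def vonNeumannEntropy {ι : Type*} [Fintype ι] [DecidableEq ι] (σ : Matrix ι ι ℂ) : ℝ :=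
  if h : σ.IsHermitian then -∑ i, h.eigenvalues i * Real.log (h.eigenvalues i) else 0

/-- Partial trace over the second tensor factor: `σ_A = Tr_B σ_{AB}`. -/
noncomputable def ptraceB {dA dB : ℕ}
    (σ : Matrix (Fin dA × Fin dB) (Fin dA × Fin dB) ℂ) :
    Matrix (Fin dA) (Fin dA) ℂ :=
  Matrix.of fun i j => ∑ k : Fin dB, σ (i, k) (j, k)

/-- Partial trace over the first tensor factor: `σ_B = Tr_A σ_{AB}`. -/
noncomputable def ptraceA {dA dB : ℕ}
    (σ : Matrix (Fin dA × Fin dB) (Fin dA × Fin dB) ℂ) :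
    Matrix (Fin dB) (Fin dB) ℂ :=
  Matrix.of fun i j => ∑ k : Fin dA, σ (k, i) (k, j)

/-- The pure state (rank-one density matrix) `|v⟩⟨v|` associated to a unit vector `v`. -/
noncomputable def pureState {ι : Type*} (v : ι → ℂ) : Matrix ι ι ℂ :=
  Matrix.of fun i j => v i * star (v j)

/-- The extension `id_A ⊗ N` of the classical channel with transition matrix `W`
(output diagonal in the fixed basis, depending only on the diagonal of the input
on the channel factor), acting on a state of the ancilla `A` and the input system. -/
noncomputable def classicalChannelExt {dA din dout : ℕ} (W : Fin dout → Fin din → ℝ)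
    (ρ : Matrix (Fin dA × Fin din) (Fin dA × Fin din) ℂ) :
    Matrix (Fin dA × Fin dout) (Fin dA × Fin dout) ℂ :=
  Matrix.of fun iy jy =>
    if iy.2 = jy.2 then ∑ x : Fin din, (W iy.2 x : ℂ) * ρ (iy.1, x) (jy.1, x) else 0

/-- Shannon entropy of a (sub)probability vector. -/
noncomputable def shannonEntropy {m : ℕ} (v : Fin m → ℝ) : ℝ :=
  -∑ y, v y * Real.log (v y)

/-- The Shannon classical capacity of the classical channel `W`: the supremum of the
mutual information `H(W q) − ∑ₓ q(x) H(W(·|x))` over input distributions `q`. -/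
noncomputable def shannonCapacity {din dout : ℕ} (W : Fin dout → Fin din → ℝ) : ℝ :=
  sSup { c : ℝ | ∃ q : Fin din → ℝ, (∀ x, 0 ≤ q x) ∧ (∑ x, q x = 1) ∧
    c = shannonEntropy (fun y => ∑ x, q x * W y x)
          - ∑ x, q x * shannonEntropy (fun y => W y x) }

/-- The one-shot dynamic capacity region of the classical channel `W`: the union over
classical-quantum input ensembles `{p(x), φˣ_{AA'}}` (with `φˣ` pure and arbitrary
finite ancilla dimension) of the triples `(C, Q, E)` satisfying
`C + 2Q ≤ I(AX;B)`, `Q + E ≤ I(A⟩BX)` and `C + Q + E ≤ I(X;B) + I(A⟩BX)`. -/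
noncomputable def oneShotDynamicRegion {din dout : ℕ} (W : Fin dout → Fin din → ℝ) :
    Set (ℝ × ℝ × ℝ) :=
  { t | ∃ (nX dA : ℕ) (p : Fin nX → ℝ) (v : Fin nX → (Fin dA × Fin din → ℂ)),
      (∀ x, 0 ≤ p x) ∧ (∑ x, p x = 1) ∧
      (∀ x, ∑ i, Complex.normSq (v x i) = 1) ∧
      (let σ : Fin nX → Matrix (Fin dA × Fin dout) (Fin dA × Fin dout) ℂ :=
        fun x => classicalChannelExt W (pureState (v x));
      let holevo : ℝ :=
        vonNeumannEntropy (∑ x, (p x : ℂ) • ptraceA (σ x))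
          - ∑ x, p x * vonNeumannEntropy (ptraceA (σ x));
      let condMutual : ℝ :=
        ∑ x, p x * (vonNeumannEntropy (ptraceB (σ x))
          + vonNeumannEntropy (ptraceA (σ x)) - vonNeumannEntropy (σ x));
      let condCoherent : ℝ :=
        ∑ x, p x * (vonNeumannEntropy (ptraceA (σ x)) - vonNeumannEntropy (σ x));
      t.1 + 2 * t.2.1 ≤ holevo + condMutual ∧
      t.2.1 + t.2.2 ≤ condCoherent ∧
      t.1 + t.2.1 + t.2.2 ≤ holevo + condCoherent) }

lemma vonNeumannEntropy_eq_sum {ι : Type*} [Fintype ι] [DecidableEq ι] {σ : Matrix ι ι ℂ}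
    (h : σ.IsHermitian) :
    vonNeumannEntropy σ = ∑ i, Real.negMulLog (h.eigenvalues i) := by
  simp [vonNeumannEntropy, h, Real.negMulLog, Finset.sum_neg_distrib]

lemma vonNeumannEntropy_eq_roots_sum {ι : Type*} [Fintype ι] [DecidableEq ι] {σ : Matrix ι ι ℂ}
    (h : σ.IsHermitian) :
    vonNeumannEntropy σ = (σ.charpoly.roots.map fun z => Real.negMulLog z.re).sum := by
  rw [vonNeumannEntropy_eq_sum h, h.roots_charpoly_eq_eigenvalues]
  simp

lemma vonNeumannEntropy_diagonal {ι : Type*} [Fintype ι] [DecidableEq ι] (d : ι → ℝ) :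
    vonNeumannEntropy (diagonal fun i => (d i : ℂ)) = ∑ i, Real.negMulLog (d i) := by
  have h : (diagonal fun i => (d i : ℂ)).IsHermitian :=
    isHermitian_diagonal_of_self_adjoint _ (by ext i; simp)
  rw [vonNeumannEntropy_eq_roots_sum h, charpoly_diagonal, Polynomial.roots_prod]
  · simp
  · simp [Finset.prod_ne_zero_iff, Polynomial.X_sub_C_ne_zero]

lemma charpoly_blockDiagonal {m o R : Type*} [Fintype m] [DecidableEq m] [Fintype o]
    [DecidableEq o] [CommRing R] (M : o → Matrix m m R) :
    (blockDiagonal M).charpoly = ∏ k, (M k).charpoly := by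
  have h : (blockDiagonal M).charmatrix = blockDiagonal fun k => (M k).charmatrix := by
    ext ⟨i, k⟩ ⟨j, l⟩
    by_cases hkl : k = l
    · subst hkl
      by_cases hij : i = j
      · subst hij; simp [blockDiagonal_apply]
      · simp [blockDiagonal_apply, hij]
    · simp [blockDiagonal_apply, hkl]
  rw [charpoly, h, det_blockDiagonal]
  rfl

lemma vonNeumannEntropy_blockDiagonal {m o : Type*} [Fintype m] [DecidableEq m] [Fintype o]
    [DecidableEq o] {M : o → Matrix m m ℂ} (hM : ∀ k, (M k).IsHermitian) :
    vonNeumannEntropy (blockDiagonal M) = ∑ k, vonNeumannEntropy (M k) := by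
  have h : (blockDiagonal M).IsHermitian := by
    rw [IsHermitian, blockDiagonal_conjTranspose]
    exact congrArg _ (funext fun k => hM k)
  rw [vonNeumannEntropy_eq_roots_sum h, charpoly_blockDiagonal, Polynomial.roots_prod _ _
    (Finset.prod_ne_zero_iff.2 fun k _ => (charpoly_monic _).ne_zero), Multiset.map_bind,
    Multiset.sum_bind]
  simp_rw [vonNeumannEntropy_eq_roots_sum (hM _)]
  rfl

/-- Subadditivity: the entropy function of a sum is at most the sum of the entropies. -/
lemma negMulLog_sum_le {ι : Type*} (s : Finset ι) {f : ι → ℝ} (hf : ∀ i ∈ s, 0 ≤ f i) :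
    Real.negMulLog (∑ i ∈ s, f i) ≤ ∑ i ∈ s, Real.negMulLog (f i) := by
  simp only [Real.negMulLog, neg_mul, Finset.sum_neg_distrib, Finset.sum_mul]
  refine neg_le_neg (Finset.sum_le_sum fun i hi => ?_)
  rcases (hf i hi).eq_or_lt with h | h
  · simp [← h]
  · exact mul_le_mul_of_nonneg_left
      (Real.log_le_log h (Finset.single_le_sum hf hi)) h.le

lemma negMulLog_trace_le_vonNeumannEntropy {ι : Type*} [Fintype ι] [DecidableEq ι]
    {σ : Matrix ι ι ℂ} (h : σ.PosSemidef) :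
    Real.negMulLog σ.trace.re ≤ vonNeumannEntropy σ := by
  rw [vonNeumannEntropy_eq_sum h.1, h.1.trace_eq_sum_eigenvalues]
  simpa using negMulLog_sum_le Finset.univ fun i _ => h.eigenvalues_nonneg i

lemma tendsto_mul_log_affine_sub_log {w l m : ℝ} (hl : 0 ≤ l) (h : w * l ≠ 0 → 0 < m) :
    Filter.Tendsto (fun s : ℝ => w * l * (Real.log (l + s * m) - Real.log s)) Filter.atTop
      (nhds (w * l * Real.log m)) := by
  by_cases hw : w * l = 0
  · simp [hw]
  have hm := h hw
  refine Filter.Tendsto.const_mul _ ?_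
  have h1 : Filter.Tendsto (fun s : ℝ => l / s + m) Filter.atTop (nhds (0 + m)) :=
    (Filter.tendsto_id.const_div_atTop l).add_const m
  rw [zero_add] at h1
  refine ((Real.continuousAt_log hm.ne').tendsto.comp h1).congr' ?_
  filter_upwards [Filter.eventually_gt_atTop 0] with s hs
  rw [Function.comp_apply, ← Real.log_div (by positivity) hs.ne']
  congr 1
  field_simp

lemma hasDerivAt_mul_log_affine {w l m s : ℝ} (hl : 0 ≤ l) (hm : 0 ≤ m) (hs : 0 ≤ s) :
    HasDerivAt (fun s : ℝ => w * l * Real.log (l + s * m)) (w * (l * m / (l + s * m))) s := by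
  rcases hl.eq_or_lt with h | h
  · simpa [← h] using hasDerivAt_const s (0 : ℝ)
  · have h1 : HasDerivAt (fun s : ℝ => l + s * m) m s := by
      simpa using ((hasDerivAt_id s).mul_const m).const_add l
    have h2 : 0 < l + s * m := by positivity
    have h3 := (h1.log h2.ne').const_mul (w * l)
    rwa [mul_assoc, ← mul_div_assoc] at h3

/-- Integrated comparison of logarithmic sums from a comparison of parallel sums. -/
lemma sum_mul_log_le_of_parallel_sum {κ ι : Type*} [Fintype κ] [Fintype ι] {w l m : κ → ℝ}
    {r D : ι → ℝ} (hl : ∀ k, 0 ≤ l k) (hm : ∀ k, 0 ≤ m k) (hD : ∀ x, 0 ≤ D x)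
    (hpos : ∀ k, w k * l k ≠ 0 → 0 < m k) (hsum : ∑ k, w k * l k = ∑ x, r x * D x)
    (hpar : ∀ s > 0, ∑ x, r x * (D x / (D x + s)) ≤ ∑ k, w k * (l k * m k / (l k + s * m k))) :
    ∑ k, w k * l k * Real.log (l k) - ∑ x, r x * D x * Real.log (D x)
      ≤ ∑ k, w k * l k * Real.log (m k) := by
  set h : ℝ → ℝ := fun s => ∑ k, w k * l k * Real.log (l k + s * m k)
    - ∑ x, r x * D x * Real.log (D x + s * 1) with hh
  have hder : ∀ s, 0 ≤ s → HasDerivAt h (∑ k, w k * (l k * m k / (l k + s * m k))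
      - ∑ x, r x * (D x * 1 / (D x + s * 1))) s := fun s hs =>
    (HasDerivAt.fun_sum fun k _ => hasDerivAt_mul_log_affine (hl k) (hm k) hs).sub
      (HasDerivAt.fun_sum fun x _ => hasDerivAt_mul_log_affine (hD x) zero_le_one hs)
  have hmono : MonotoneOn h (Set.Ici 0) := by
    refine monotoneOn_of_deriv_nonneg (convex_Ici 0)
      (fun s hs => (hder s hs).continuousAt.continuousWithinAt) ?_ ?_
    · intro s hs
      rw [interior_Ici] at hs
      exact (hder s (le_of_lt hs)).differentiableAt.differentiableWithinAt
    · intro s hs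
      rw [interior_Ici] at hs
      rw [(hder s (le_of_lt hs)).deriv]
      simpa using hpar s hs
  have hlim : Filter.Tendsto h Filter.atTop
      (nhds (∑ k, w k * l k * Real.log (m k) - ∑ x, r x * D x * Real.log 1)) := by
    refine ((tendsto_finsetSum _ fun k _ =>
      tendsto_mul_log_affine_sub_log (hl k) (hpos k)).sub (tendsto_finsetSum _ fun x _ =>
      tendsto_mul_log_affine_sub_log (hD x) fun _ => one_pos)).congr fun s => ?_
    simp only [hh, mul_sub, Finset.sum_sub_distrib, ← Finset.sum_mul, hsum]
    ring
  have hle := ge_of_tendsto hlim (Filter.eventually_atTop.2 ⟨0, fun s hs =>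
    hmono (Set.mem_Ici.2 le_rfl) hs hs⟩)
  simpa [hh] using hle

lemma parallel_sum_mul_norm_sq_le {E : Type*} [NormedAddCommGroup E] [InnerProductSpace ℂ E]
    {a u b : E} (h : inner ℂ a a = inner ℂ u a + inner ℂ a b) {D s : ℝ} (hD : 0 ≤ D) (hs : 0 < s) :
    s * (‖a‖ ^ 2 * (D / (D + s))) ≤ D * ‖u‖ ^ 2 + s * ‖b‖ ^ 2 := by
  have hr : ‖a‖ ≤ ‖u‖ + ‖b‖ := by
    rcases (norm_nonneg a).eq_or_lt with h0 | h0
    · rw [← h0]; positivity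
    · refine le_of_mul_le_mul_right ?_ h0
      calc ‖a‖ * ‖a‖ = ‖inner ℂ a a‖ := by rw [inner_self_eq_norm_sq_to_K]; simp [sq]
        _ ≤ ‖inner ℂ u a‖ + ‖inner ℂ a b‖ := h ▸ norm_add_le _ _
        _ ≤ ‖u‖ * ‖a‖ + ‖a‖ * ‖b‖ := add_le_add (norm_inner_le_norm _ _) (norm_inner_le_norm _ _)
        _ = _ := by ring
  have h2 : ‖a‖ ^ 2 ≤ (‖u‖ + ‖b‖) ^ 2 := pow_le_pow_left₀ (norm_nonneg _) hr 2
  have h3 : 0 < D + s := by positivity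
  rw [← mul_div_assoc, ← mul_div_assoc, div_le_iff₀ h3]
  nlinarith [sq_nonneg (D * ‖u‖ - s * ‖b‖), mul_le_mul_of_nonneg_left h2 (mul_nonneg hs.le hD)]

lemma mul_diagonal_conjTranspose_apply_self {m n : Type*} [Fintype n] [DecidableEq n]
    (M : Matrix m n ℂ) (d : n → ℝ) (i : m) :
    (M * (diagonal (fun j => (d j : ℂ)) : Matrix n n ℂ) * Mᴴ) i i
      = ((∑ j, d j * Complex.normSq (M i j) : ℝ) : ℂ) := by
  rw [mul_apply]
  simp only [mul_diagonal, conjTranspose_apply, Complex.ofReal_sum, Complex.ofReal_mul,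
    Complex.normSq_eq_conj_mul_self, Complex.star_def]
  exact Finset.sum_congr rfl fun j _ => by ring

lemma trace_mul_diagonal_conjTranspose {m n : Type*} [Fintype m] [Fintype n] [DecidableEq n]
    (M : Matrix m n ℂ) (d : n → ℝ) :
    (M * (diagonal (fun j => (d j : ℂ)) : Matrix n n ℂ) * Mᴴ).trace
      = ((∑ i, ∑ j, d j * Complex.normSq (M i j) : ℝ) : ℂ) := by
  rw [trace, Complex.ofReal_sum]
  exact Finset.sum_congr rfl fun i _ => mul_diagonal_conjTranspose_apply_self M d i

lemma sum_parallel_sum_le_trace {n ι : Type*} [Fintype n] [DecidableEq n] [Fintype ι]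
    [DecidableEq ι] (A : Matrix n ι ℂ) {D : ι → ℝ} (hD : ∀ x, 0 ≤ D x) (Z : Matrix n n ℂ)
    {s : ℝ} (hs : 0 < s) :
    s * ∑ x, (∑ i, Complex.normSq (A i x)) * (D x / (D x + s))
      ≤ (Zᴴ * (A * (diagonal (fun x => (D x : ℂ)) : Matrix ι ι ℂ) * Aᴴ) * Z).trace.re
        + s * ((1 - Z) * (A * Aᴴ) * (1 - Z)ᴴ).trace.re := by
  have h1 : Zᴴ * (A * (diagonal (fun x => (D x : ℂ)) : Matrix ι ι ℂ) * Aᴴ) * Z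
      = (Zᴴ * A) * (diagonal (fun x => (D x : ℂ)) : Matrix ι ι ℂ) * (Zᴴ * A)ᴴ := by
    simp [conjTranspose_mul, Matrix.mul_assoc]
  have h2 : (1 - Z) * (A * Aᴴ) * (1 - Z)ᴴ
      = ((1 - Z) * A) * (diagonal (fun _ => ((1 : ℝ) : ℂ)) : Matrix ι ι ℂ) * ((1 - Z) * A)ᴴ := by
    rw [Complex.ofReal_one, diagonal_one, Matrix.mul_one, conjTranspose_mul]
    simp only [Matrix.mul_assoc]
  rw [h1, h2, trace_mul_diagonal_conjTranspose, trace_mul_diagonal_conjTranspose,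
    Complex.ofReal_re, Complex.ofReal_re, Finset.sum_comm, Finset.sum_comm (s := Finset.univ (α := n)),
    Finset.mul_sum, Finset.mul_sum, ← Finset.sum_add_distrib]
  refine Finset.sum_le_sum fun x _ => ?_
  have key := parallel_sum_mul_norm_sq_le (a := WithLp.toLp 2 (A.col x))
    (u := WithLp.toLp 2 ((Zᴴ * A).col x)) (b := WithLp.toLp 2 (((1 - Z) * A).col x)) ?_ (hD x) hs
  · simpa [EuclideanSpace.norm_sq_eq, Complex.normSq_eq_norm_sq, Finset.mul_sum] using key
  · simp only [EuclideanSpace.inner_toLp_toLp, dotProduct, Pi.star_apply, col_apply]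
    have h3 : (Aᴴ * A : Matrix ι ι ℂ) x x
        = ((Zᴴ * A)ᴴ * A : Matrix ι ι ℂ) x x + (Aᴴ * ((1 - Z) * A) : Matrix ι ι ℂ) x x := by
      rw [← Matrix.add_apply]
      simp [Matrix.sub_mul, Matrix.mul_sub, Matrix.mul_assoc]
    simp only [mul_apply (M := Aᴴ), mul_apply (M := (Zᴴ * A)ᴴ), conjTranspose_apply] at h3
    simp only [mul_comm (_ : ℂ) (star _)]
    exact h3

/-- Monotonicity of the relative entropy under a preparation channel: the relative entropy of
`A D Aᴴ` with respect to `A Aᴴ` is at most that of the underlying weights. -/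
lemma sum_eigenvalue_log_sub_le {n ι : Type*} [Fintype n] [DecidableEq n] [Fintype ι]
    [DecidableEq ι] (A : Matrix n ι ℂ) {D : ι → ℝ} (hD : ∀ x, 0 ≤ D x)
    {U V : Matrix n n ℂ} (hU : Uᴴ * U = 1) (hV : Vᴴ * V = 1)
    {l m : n → ℝ} (hl : ∀ i, 0 ≤ l i) (hm : ∀ j, 0 ≤ m j)
    (hω : A * (diagonal (fun x => (D x : ℂ)) : Matrix ι ι ℂ) * Aᴴ
      = U * (diagonal (fun i => (l i : ℂ)) : Matrix n n ℂ) * Uᴴ)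
    (hσ : A * Aᴴ = V * (diagonal (fun j => (m j : ℂ)) : Matrix n n ℂ) * Vᴴ) :
    ∑ i, l i * Real.log (l i) - ∑ x, (∑ i, Complex.normSq (A i x)) * D x * Real.log (D x)
      ≤ ∑ j, ((Vᴴ * (A * (diagonal (fun x => (D x : ℂ)) : Matrix ι ι ℂ) * Aᴴ) * V) j j).re
          * Real.log (m j) := by
  have hU' : U * Uᴴ = 1 := mul_eq_one_comm.1 hU
  have hV' : V * Vᴴ = 1 := mul_eq_one_comm.1 hV
  set c : Matrix n n ℂ := Vᴴ * U with hc
  set P : n → n → ℝ := fun j i => Complex.normSq (c j i) with hP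
  have hcc : cᴴ * c = 1 := by
    rw [hc, conjTranspose_mul, conjTranspose_conjTranspose, Matrix.mul_assoc,
      ← Matrix.mul_assoc V, hV', Matrix.one_mul, hU]
  have hPsum : ∀ i, ∑ j, P j i = 1 := fun i => by
    have h := congrFun (congrFun hcc i) i
    simp only [mul_apply, conjTranspose_apply, one_apply_eq, Complex.star_def,
      ← Complex.normSq_eq_conj_mul_self] at h
    exact_mod_cast h
  have hdiag : ∀ j, ((Vᴴ * (A * (diagonal (fun x => (D x : ℂ)) : Matrix ι ι ℂ) * Aᴴ) * V) j j).re
      = ∑ i, P j i * l i := fun j => by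
    have h : Vᴴ * (U * (diagonal (fun i => (l i : ℂ)) : Matrix n n ℂ) * Uᴴ) * V
        = c * (diagonal (fun i => (l i : ℂ)) : Matrix n n ℂ) * cᴴ := by
      simp [hc, conjTranspose_mul, Matrix.mul_assoc]
    rw [hω, h, mul_diagonal_conjTranspose_apply_self, Complex.ofReal_re]
    exact Finset.sum_congr rfl fun i _ => mul_comm _ _
  have hdiag' : ∀ j, ∑ i, P j i * l i = ∑ x, D x * Complex.normSq ((Vᴴ * A) j x) := fun j => by
    have h : Vᴴ * (A * (diagonal (fun x => (D x : ℂ)) : Matrix ι ι ℂ) * Aᴴ) * V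
        = (Vᴴ * A) * (diagonal (fun x => (D x : ℂ)) : Matrix ι ι ℂ) * (Vᴴ * A)ᴴ := by
      simp [conjTranspose_mul, Matrix.mul_assoc]
    rw [← hdiag, h, mul_diagonal_conjTranspose_apply_self, Complex.ofReal_re]
  have hdiagσ : ∀ j, m j = ∑ x, Complex.normSq ((Vᴴ * A) j x) := fun j => by
    have h : (diagonal (fun j => (m j : ℂ)) : Matrix n n ℂ)
        = (Vᴴ * A) * (diagonal (fun _ => ((1 : ℝ) : ℂ)) : Matrix ι ι ℂ) * (Vᴴ * A)ᴴ := by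
      calc (diagonal (fun j => (m j : ℂ)) : Matrix n n ℂ)
          = Vᴴ * (V * (diagonal (fun j => (m j : ℂ)) : Matrix n n ℂ) * Vᴴ) * V := by
            rw [Matrix.mul_assoc V, ← Matrix.mul_assoc, hV, Matrix.one_mul, Matrix.mul_assoc, hV,
              Matrix.mul_one]
        _ = _ := by
            rw [← hσ, Complex.ofReal_one, diagonal_one, Matrix.mul_one]
            simp [conjTranspose_mul, Matrix.mul_assoc]
    have h' := congrFun (congrFun h j) j
    rw [mul_diagonal_conjTranspose_apply_self, diagonal_apply_eq, Complex.ofReal_inj] at h'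
    simpa using h'
  have key := sum_mul_log_le_of_parallel_sum (κ := n × n) (w := fun k => P k.1 k.2)
    (l := fun k => l k.2) (m := fun k => m k.1) (r := fun x => ∑ i, Complex.normSq (A i x))
    (D := D) (fun k => hl k.2) (fun k => hm k.1) hD ?_ ?_ ?_
  · simp only [Fintype.sum_prod_type] at key
    rw [Finset.sum_comm] at key
    simp only [mul_assoc, ← Finset.sum_mul, hPsum, one_mul] at key
    simp only [hdiag, Finset.sum_mul]
    simpa only [mul_assoc, Finset.sum_mul] using key
  · rintro ⟨j, i⟩ hk
    refine (hm j).lt_of_ne' fun h0 => hk ?_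
    rw [hdiagσ j, Finset.sum_eq_zero_iff_of_nonneg fun _ _ => Complex.normSq_nonneg _] at h0
    have h1 : ∑ i, P j i * l i = 0 := by
      rw [hdiag' j]
      exact Finset.sum_eq_zero fun x hx => by rw [h0 x hx, mul_zero]
    rw [Finset.sum_eq_zero_iff_of_nonneg fun i _ =>
      mul_nonneg (Complex.normSq_nonneg _) (hl i)] at h1
    exact h1 i (Finset.mem_univ _)
  · have h := congrArg (fun M => (trace M).re) hω
    simp only [trace_mul_diagonal_conjTranspose, Complex.ofReal_re] at h
    have hUn : ∀ i, ∑ j, Complex.normSq (U j i) = 1 := fun i => by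
      have h := congrFun (congrFun hU i) i
      simp only [mul_apply, conjTranspose_apply, one_apply_eq, Complex.star_def,
        ← Complex.normSq_eq_conj_mul_self] at h
      exact_mod_cast h
    rw [Finset.sum_comm, Finset.sum_comm (s := Finset.univ (α := n))] at h
    simp only [← Finset.mul_sum, hUn, mul_one] at h
    simp only [Fintype.sum_prod_type]
    rw [Finset.sum_comm]
    simp only [← Finset.sum_mul, hPsum, one_mul]
    rw [← h]
    exact Finset.sum_congr rfl fun x _ => mul_comm _ _
  · intro s hs
    set z : n → n → ℝ := fun j i => s * m j / (l i + s * m j) with hz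
    set Y : Matrix n n ℂ := of fun j i => (z j i : ℂ) * c j i with hY
    set Z : Matrix n n ℂ := U * Yᴴ * Vᴴ with hZ
    have hA := sum_parallel_sum_le_trace A hD Z hs
    have h1 : (Zᴴ * (A * (diagonal (fun x => (D x : ℂ)) : Matrix ι ι ℂ) * Aᴴ) * Z).trace
        = ((∑ j, ∑ i, l i * Complex.normSq (Y j i) : ℝ) : ℂ) := by
      rw [hω, ← trace_mul_diagonal_conjTranspose]
      have : Zᴴ * (U * (diagonal (fun i => (l i : ℂ)) : Matrix n n ℂ) * Uᴴ) * Z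
          = V * (Y * (diagonal (fun i => (l i : ℂ)) : Matrix n n ℂ) * Yᴴ * Vᴴ) := by
        simp only [hZ, conjTranspose_mul, conjTranspose_conjTranspose, Matrix.mul_assoc]
        rw [← Matrix.mul_assoc Uᴴ U, hU, Matrix.one_mul, ← Matrix.mul_assoc Uᴴ U, hU,
          Matrix.one_mul]
      rw [this, trace_mul_comm, Matrix.mul_assoc, hV, Matrix.mul_one]
    have h2 : ((1 - Z) * (A * Aᴴ) * (1 - Z)ᴴ).trace
        = ((∑ i, ∑ j, m j * Complex.normSq ((c - Y)ᴴ i j) : ℝ) : ℂ) := by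
      rw [hσ, ← trace_mul_diagonal_conjTranspose]
      have hZ1 : (1 - Z) * V = U * (c - Y)ᴴ := by
        rw [hZ, conjTranspose_sub, Matrix.mul_sub, Matrix.sub_mul, Matrix.mul_assoc _ Vᴴ, hV, hc,
          conjTranspose_mul, conjTranspose_conjTranspose, ← Matrix.mul_assoc U, hU']
        simp
      have : (1 - Z) * (V * (diagonal (fun j => (m j : ℂ)) : Matrix n n ℂ) * Vᴴ) * (1 - Z)ᴴ
          = ((1 - Z) * V) * (diagonal (fun j => (m j : ℂ)) : Matrix n n ℂ) * ((1 - Z) * V)ᴴ := by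
        simp only [conjTranspose_mul, Matrix.mul_assoc]
      rw [this, hZ1, conjTranspose_mul U, Matrix.mul_assoc U, Matrix.mul_assoc U, trace_mul_comm,
        ← Matrix.mul_assoc _ _ Uᴴ, Matrix.mul_assoc _ Uᴴ, hU, Matrix.mul_one]
    rw [h1, h2, Complex.ofReal_re, Complex.ofReal_re,
      Finset.sum_comm (f := fun i j => m j * Complex.normSq ((c - Y)ᴴ i j))] at hA
    refine le_of_mul_le_mul_left (hA.trans_eq ?_) hs
    rw [Fintype.sum_prod_type, Finset.mul_sum, Finset.mul_sum, ← Finset.sum_add_distrib]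
    refine Finset.sum_congr rfl fun j _ => ?_
    rw [Finset.mul_sum, Finset.mul_sum, ← Finset.sum_add_distrib]
    refine Finset.sum_congr rfl fun i _ => ?_
    have h3 : (c - Y)ᴴ i j = star (((1 - z j i : ℝ) : ℂ) * c j i) := by
      simp [hY, sub_mul]
    have h4 : Y j i = (z j i : ℂ) * c j i := rfl
    rw [h3, h4, Complex.star_def, Complex.normSq_conj, Complex.normSq_mul, Complex.normSq_mul,
      Complex.normSq_ofReal, Complex.normSq_ofReal]
    change _ = s * (P j i * _)
    simp only [hP, hz]
    by_cases h0 : l i + s * m j = 0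
    · have : s * m j = 0 := by nlinarith [hl i, mul_nonneg hs.le (hm j)]
      have : m j = 0 := by simpa [hs.ne'] using this
      simp [this]
    · field_simp
      ring

lemma posSemidef_mul_diagonal_mul_conjTranspose {n ι : Type*} [Fintype n] [DecidableEq n]
    [Fintype ι] [DecidableEq ι] (A : Matrix n ι ℂ) {d : ι → ℝ} (hd : ∀ x, 0 ≤ d x) :
    (A * (diagonal (fun x => (d x : ℂ)) : Matrix ι ι ℂ) * Aᴴ).PosSemidef :=
  (PosSemidef.diagonal fun x => by simpa using hd x).mul_mul_conjTranspose_same A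

lemma exists_eq_unitary_mul_diagonal {n : Type*} [Fintype n] [DecidableEq n]
    {σ : Matrix n n ℂ} (h : σ.IsHermitian) :
    ∃ U : Matrix n n ℂ, Uᴴ * U = 1 ∧
      σ = U * (diagonal (fun i => (h.eigenvalues i : ℂ)) : Matrix n n ℂ) * Uᴴ :=
  ⟨h.eigenvectorUnitary, Unitary.coe_star_mul_self h.eigenvectorUnitary, by
    conv_lhs => rw [h.spectral_theorem, Unitary.conjStarAlgAut_apply]
    rfl⟩

/-- The conditional entropy of a classical output given quantum side information about its input is
at least the conditional entropy given the classical input itself. -/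
lemma vonNeumannEntropy_sub_sum_le {n ι o : Type*} [Fintype n] [DecidableEq n] [Fintype ι]
    [DecidableEq ι] [Fintype o] (A : Matrix n ι ℂ) {W : o → ι → ℝ} (hW : ∀ y x, 0 ≤ W y x)
    (hWsum : ∀ x, ∑ y, W y x = 1) :
    vonNeumannEntropy (A * Aᴴ)
        - ∑ y, vonNeumannEntropy (A * (diagonal (fun x => (W y x : ℂ)) : Matrix ι ι ℂ) * Aᴴ)
      ≤ -∑ x, (∑ i, Complex.normSq (A i x)) * ∑ y, Real.negMulLog (W y x) := by
  have hσ := posSemidef_self_mul_conjTranspose A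
  have hω := fun y => posSemidef_mul_diagonal_mul_conjTranspose A (hW y)
  obtain ⟨V, hV, hVσ⟩ := exists_eq_unitary_mul_diagonal hσ.1
  have hdiag : Vᴴ * (A * Aᴴ) * V = diagonal fun i => (hσ.1.eigenvalues i : ℂ) :=
    (congrArg (fun M => Vᴴ * M * V) hVσ).trans <| by
      rw [Matrix.mul_assoc V, ← Matrix.mul_assoc, hV, Matrix.one_mul, Matrix.mul_assoc, hV,
        Matrix.mul_one]
  have hsum : ∀ j : n, ∑ y, ((Vᴴ * (A * (diagonal (fun x => (W y x : ℂ)) : Matrix ι ι ℂ) * Aᴴ)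
      * V) j j).re = hσ.1.eigenvalues j := fun j => by
    have h1 : ∑ y, (diagonal (fun x => (W y x : ℂ)) : Matrix ι ι ℂ) = 1 := by
      ext x x'
      rw [Matrix.sum_apply]
      by_cases hx : x = x'
      · subst hx
        simpa [diagonal_apply] using congrArg (fun r : ℝ => (r : ℂ)) (hWsum x)
      · simp [one_apply, hx]
    rw [← Complex.re_sum, ← Matrix.sum_apply, ← Finset.sum_mul, ← Matrix.mul_sum,
      ← Matrix.sum_mul, ← Matrix.mul_sum, h1, Matrix.mul_one, hdiag]
    simp
  have hy : ∀ y, -vonNeumannEntropy (A * (diagonal (fun x => (W y x : ℂ)) : Matrix ι ι ℂ) * Aᴴ)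
      + ∑ x, (∑ i, Complex.normSq (A i x)) * Real.negMulLog (W y x)
      ≤ ∑ j, ((Vᴴ * (A * (diagonal (fun x => (W y x : ℂ)) : Matrix ι ι ℂ) * Aᴴ) * V) j j).re
          * Real.log (hσ.1.eigenvalues j) := fun y => by
    obtain ⟨U, hU, hUω⟩ := exists_eq_unitary_mul_diagonal (hω y).1
    have := sum_eigenvalue_log_sub_le A (hW y) hU hV (hω y).eigenvalues_nonneg
      hσ.eigenvalues_nonneg hUω hVσ
    rw [vonNeumannEntropy_eq_sum (hω y).1]
    simpa [Real.negMulLog, Finset.sum_neg_distrib, mul_assoc, sub_eq_add_neg] using this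
  have h := Finset.sum_le_sum fun y (_ : y ∈ Finset.univ) => hy y
  rw [Finset.sum_comm (s := Finset.univ (α := o)) (t := Finset.univ (α := n))] at h
  simp only [← Finset.sum_mul, hsum, Finset.sum_add_distrib, Finset.sum_neg_distrib] at h
  rw [Finset.sum_comm (s := Finset.univ (α := o)) (t := Finset.univ (α := ι))] at h
  simp only [← Finset.mul_sum] at h
  rw [vonNeumannEntropy_eq_sum hσ.1]
  simp only [Real.negMulLog, neg_mul, Finset.sum_neg_distrib] at h ⊢
  linarith

lemma shannonEntropy_eq_sum {m : ℕ} (v : Fin m → ℝ) :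
    shannonEntropy v = ∑ y, Real.negMulLog (v y) := by
  simp [shannonEntropy, Real.negMulLog, Finset.sum_neg_distrib]

/-- The mutual information between input and output of `W` for the input distribution `q`. -/
noncomputable def mutualInformation {din dout : ℕ} (W : Fin dout → Fin din → ℝ)
    (q : Fin din → ℝ) : ℝ :=
  shannonEntropy (fun y => ∑ x, q x * W y x) - ∑ x, q x * shannonEntropy (fun y => W y x)

lemma continuous_mutualInformation {din dout : ℕ} (W : Fin dout → Fin din → ℝ) :
    Continuous (mutualInformation W) := by
  unfold mutualInformation
  simp only [shannonEntropy_eq_sum]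
  fun_prop

lemma shannonCapacity_eq_sSup_image {din dout : ℕ} (W : Fin dout → Fin din → ℝ) :
    shannonCapacity W = sSup (mutualInformation W '' stdSimplex ℝ (Fin din)) := by
  unfold shannonCapacity
  congr 1
  ext c
  simp only [Set.mem_ofPred_eq, Set.mem_image, stdSimplex, and_assoc]
  exact exists_congr fun q => and_congr_right fun _ => and_congr_right fun _ => eq_comm

lemma mutualInformation_le_shannonCapacity {din dout : ℕ} (W : Fin dout → Fin din → ℝ)
    {q : Fin din → ℝ} (hq : q ∈ stdSimplex ℝ (Fin din)) :
    mutualInformation W q ≤ shannonCapacity W := by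
  rw [shannonCapacity_eq_sSup_image]
  exact le_csSup ((isCompact_stdSimplex ℝ _).image (continuous_mutualInformation W)).bddAbove
    (Set.mem_image_of_mem _ hq)

lemma exists_mutualInformation_eq_shannonCapacity {din dout : ℕ} (hdin : 0 < din)
    (W : Fin dout → Fin din → ℝ) :
    ∃ q ∈ stdSimplex ℝ (Fin din), mutualInformation W q = shannonCapacity W := by
  rw [shannonCapacity_eq_sSup_image]
  exact ((isCompact_stdSimplex ℝ _).image (continuous_mutualInformation W)).sSup_mem
    (Set.Nonempty.image _ ⟨_, single_mem_stdSimplex ℝ (⟨0, hdin⟩ : Fin din)⟩)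

section ChannelOutput

variable {dA din dout : ℕ} (W : Fin dout → Fin din → ℝ) (v : Fin dA × Fin din → ℂ)

/-- The distribution of the channel input when measured in the fixed basis. -/
noncomputable def inputWeight (x : Fin din) : ℝ := ∑ i, Complex.normSq (v (i, x))

lemma classicalChannelExt_pureState :
    classicalChannelExt W (pureState v) = blockDiagonal fun y =>
      (of fun i x => v (i, x) : Matrix (Fin dA) (Fin din) ℂ)
        * (diagonal (fun x => (W y x : ℂ)) : Matrix (Fin din) (Fin din) ℂ)
        * (of fun i x => v (i, x) : Matrix (Fin dA) (Fin din) ℂ)ᴴ := by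
  ext ⟨i, y⟩ ⟨j, y'⟩
  by_cases h : y = y'
  · subst h
    simp only [classicalChannelExt, pureState, of_apply, if_true, blockDiagonal_apply]
    rw [mul_apply]
    simp only [mul_diagonal, conjTranspose_apply, of_apply]
    exact Finset.sum_congr rfl fun x _ => by ring
  · simp [classicalChannelExt, blockDiagonal_apply, h]

lemma ptraceA_classicalChannelExt_pureState :
    ptraceA (classicalChannelExt W (pureState v))
      = diagonal fun y => ((∑ x, inputWeight v x * W y x : ℝ) : ℂ) := by
  ext y y'
  by_cases h : y = y'
  · subst h
    simp only [ptraceA, classicalChannelExt, pureState, of_apply, if_true, diagonal_apply_eq,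
      inputWeight]
    rw [Finset.sum_comm]
    simp only [Complex.ofReal_sum, Complex.ofReal_mul, Complex.normSq_eq_conj_mul_self,
      Finset.sum_mul]
    exact Finset.sum_congr rfl fun x _ => Finset.sum_congr rfl fun i _ => by
      rw [Complex.star_def]; ring
  · simp [ptraceA, classicalChannelExt, h]

lemma ptraceB_classicalChannelExt_pureState (hWsum : ∀ x, ∑ y, W y x = 1) :
    ptraceB (classicalChannelExt W (pureState v))
      = (of fun i x => v (i, x) : Matrix (Fin dA) (Fin din) ℂ)
        * (of fun i x => v (i, x) : Matrix (Fin dA) (Fin din) ℂ)ᴴ := by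
  ext i j
  rw [mul_apply]
  simp only [ptraceB, classicalChannelExt, pureState, of_apply, if_true, conjTranspose_apply]
  rw [Finset.sum_comm]
  refine Finset.sum_congr rfl fun x _ => ?_
  rw [← Finset.sum_mul, ← Complex.ofReal_sum, hWsum, Complex.ofReal_one, one_mul]

lemma inputWeight_nonneg (x : Fin din) : 0 ≤ inputWeight v x :=
  Finset.sum_nonneg fun _ _ => Complex.normSq_nonneg _

lemma sum_inputWeight (hv : ∑ i, Complex.normSq (v i) = 1) : ∑ x, inputWeight v x = 1 := by
  rw [← hv, Fintype.sum_prod_type, Finset.sum_comm]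
  rfl

lemma vonNeumannEntropy_ptraceA_le (hW : ∀ y x, 0 ≤ W y x) :
    vonNeumannEntropy (ptraceA (classicalChannelExt W (pureState v)))
      ≤ vonNeumannEntropy (classicalChannelExt W (pureState v)) := by
  have hω := fun y => posSemidef_mul_diagonal_mul_conjTranspose
    (of fun i x => v (i, x) : Matrix (Fin dA) (Fin din) ℂ) (hW y)
  rw [ptraceA_classicalChannelExt_pureState, vonNeumannEntropy_diagonal,
    classicalChannelExt_pureState, vonNeumannEntropy_blockDiagonal fun y => (hω y).1]
  refine Finset.sum_le_sum fun y _ => ?_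
  refine le_of_eq_of_le ?_ (negMulLog_trace_le_vonNeumannEntropy (hω y))
  rw [trace_mul_diagonal_conjTranspose, Complex.ofReal_re, Finset.sum_comm]
  congr 1
  exact Finset.sum_congr rfl fun x _ => by
    simp [inputWeight, Finset.mul_sum, mul_comm]

lemma vonNeumannEntropy_ptraceB_nonneg (hWsum : ∀ x, ∑ y, W y x = 1)
    (hv : ∑ i, Complex.normSq (v i) = 1) :
    0 ≤ vonNeumannEntropy (ptraceB (classicalChannelExt W (pureState v))) := by
  rw [ptraceB_classicalChannelExt_pureState W v hWsum]
  refine le_of_eq_of_le ?_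
    (negMulLog_trace_le_vonNeumannEntropy (posSemidef_self_mul_conjTranspose _))
  have h := trace_mul_diagonal_conjTranspose
    (of fun i x => v (i, x) : Matrix (Fin dA) (Fin din) ℂ) fun _ => 1
  rw [Complex.ofReal_one, diagonal_one, Matrix.mul_one] at h
  rw [h, Complex.ofReal_re]
  simp only [one_mul, of_apply, ← Fintype.sum_prod_type', Prod.mk.eta, hv, Real.negMulLog_one]

lemma vonNeumannEntropy_ptraceB_sub_le (hW : ∀ y x, 0 ≤ W y x) (hWsum : ∀ x, ∑ y, W y x = 1) :
    vonNeumannEntropy (ptraceB (classicalChannelExt W (pureState v)))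
        - vonNeumannEntropy (classicalChannelExt W (pureState v))
      ≤ -∑ x, inputWeight v x * shannonEntropy fun y => W y x := by
  have hω := fun y => posSemidef_mul_diagonal_mul_conjTranspose
    (of fun i x => v (i, x) : Matrix (Fin dA) (Fin din) ℂ) (hW y)
  rw [ptraceB_classicalChannelExt_pureState W v hWsum, classicalChannelExt_pureState,
    vonNeumannEntropy_blockDiagonal fun y => (hω y).1]
  simp only [shannonEntropy_eq_sum]
  exact vonNeumannEntropy_sub_sum_le _ hW hWsum

lemma vonNeumannEntropy_sum_smul_ptraceA {nX : ℕ} (p : Fin nX → ℝ)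
    (v : Fin nX → (Fin dA × Fin din → ℂ)) :
    vonNeumannEntropy (∑ k, (p k : ℂ) • ptraceA (classicalChannelExt W (pureState (v k))))
      = shannonEntropy fun y => ∑ x, (∑ k, p k * inputWeight (v k) x) * W y x := by
  have h : ∑ k, (p k : ℂ) • ptraceA (classicalChannelExt W (pureState (v k)))
      = diagonal fun y => ((∑ x, (∑ k, p k * inputWeight (v k) x) * W y x : ℝ) : ℂ) := by
    ext y y'
    simp only [ptraceA_classicalChannelExt_pureState, Matrix.sum_apply, Matrix.smul_apply,
      smul_eq_mul]
    by_cases hy : y = y'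
    · subst hy
      simp only [diagonal_apply_eq, ← Complex.ofReal_mul, ← Complex.ofReal_sum, Finset.mul_sum,
        Finset.sum_mul]
      rw [Finset.sum_comm]
      simp only [mul_assoc]
    · simp [hy]
  rw [h, vonNeumannEntropy_diagonal, shannonEntropy_eq_sum]

/-- Sending basis states with a trivial ancilla outputs the corresponding row of `W`. -/
lemma classicalChannelExt_pureState_single (k : Fin din) :
    classicalChannelExt W (pureState (Pi.single ((0 : Fin 1), k) 1))
      = diagonal fun iy => (W iy.2 k : ℂ) := by
  ext ⟨i, y⟩ ⟨j, y'⟩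
  obtain rfl := Subsingleton.elim i j
  by_cases h : y = y'
  · subst h
    simp [classicalChannelExt, pureState, Pi.single_apply, Prod.ext_iff,
      Subsingleton.elim i 0, apply_ite]
  · simp [classicalChannelExt, h]

lemma inputWeight_single (k x : Fin din) :
    inputWeight (Pi.single ((0 : Fin 1), k) (1 : ℂ)) x = if x = k then 1 else 0 := by
  by_cases h : x = k <;> simp [inputWeight, Pi.single_apply, h]

end ChannelOutput

/-- For a classical channel with (column-)stochastic transition matrix `W`, the one-shot
dynamic capacity region is exactly the set of triples `(C, Q, E)` with
`C + 2Q ≤ C_cl`, `Q + E ≤ 0` and `C + Q + E ≤ C_cl`, where `C_cl` is the Shannon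
classical capacity of the channel. -/
theorem stmt_18 (din dout : ℕ) (hdin : 0 < din) (hdout : 0 < dout)
    (W : Fin dout → Fin din → ℝ)
    (hW : ∀ y x, 0 ≤ W y x) (hWsum : ∀ x, ∑ y, W y x = 1) :
    oneShotDynamicRegion W =
      { t : ℝ × ℝ × ℝ | t.1 + 2 * t.2.1 ≤ shannonCapacity W ∧
          t.2.1 + t.2.2 ≤ 0 ∧
          t.1 + t.2.1 + t.2.2 ≤ shannonCapacity W } := by
  have hsup := fun q hq => mutualInformation_le_shannonCapacity W (q := q) hq
  ext ⟨C, Q, E⟩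
  constructor
  · rintro ⟨nX, dA, p, v, hp, hpsum, hv, h1, h2, h3⟩
    rw [vonNeumannEntropy_sum_smul_ptraceA] at h1 h3
    simp only [mul_add, mul_sub, Finset.sum_add_distrib, Finset.sum_sub_distrib] at h1 h2 h3
    have hcoh := Finset.sum_le_sum fun k (_ : k ∈ Finset.univ) =>
      mul_le_mul_of_nonneg_left (vonNeumannEntropy_ptraceA_le W (v k) hW) (hp k)
    have hanc := Finset.sum_nonneg fun k (_ : k ∈ Finset.univ) =>
      mul_nonneg (hp k) (vonNeumannEntropy_ptraceB_nonneg W (v k) hWsum (hv k))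
    have hcond := Finset.sum_le_sum fun k (_ : k ∈ Finset.univ) =>
      mul_le_mul_of_nonneg_left (vonNeumannEntropy_ptraceB_sub_le W (v k) hW hWsum) (hp k)
    have hq := hsup (fun x => ∑ k, p k * inputWeight (v k) x)
      ⟨fun x => Finset.sum_nonneg fun k _ => mul_nonneg (hp k) (inputWeight_nonneg _ _), by
        rw [Finset.sum_comm]
        simp only [← Finset.mul_sum, sum_inputWeight _ (hv _), mul_one, hpsum]⟩
    have hswap : ∑ x, (∑ k, p k * inputWeight (v k) x) * shannonEntropy (fun y => W y x)
        = ∑ k, p k * ∑ x, inputWeight (v k) x * shannonEntropy (fun y => W y x) := by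
      simp only [Finset.sum_mul, Finset.mul_sum]
      rw [Finset.sum_comm]
      simp only [mul_assoc]
    rw [mutualInformation, hswap] at hq
    simp only [mul_sub, mul_neg, Finset.sum_sub_distrib, Finset.sum_neg_distrib] at hcond
    refine ⟨?_, ?_, ?_⟩ <;> simp only at h1 h2 h3 ⊢ <;> linarith
  · rintro ⟨h1, h2, h3⟩
    obtain ⟨q, hq, hqC⟩ := exists_mutualInformation_eq_shannonCapacity hdin W
    have hA : ∀ k, vonNeumannEntropy (ptraceA (classicalChannelExt W
        (pureState (Pi.single ((0 : Fin 1), k) 1)))) = shannonEntropy fun y => W y k := fun k => by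
      simp [ptraceA_classicalChannelExt_pureState, vonNeumannEntropy_diagonal, inputWeight_single,
        shannonEntropy_eq_sum, -Complex.ofReal_sum]
    have hAB : ∀ k, vonNeumannEntropy (classicalChannelExt W
        (pureState (Pi.single ((0 : Fin 1), k) 1))) = shannonEntropy fun y => W y k := fun k => by
      rw [classicalChannelExt_pureState_single, vonNeumannEntropy_diagonal]
      simp [Fintype.sum_prod_type, shannonEntropy_eq_sum]
    have hB : ∀ k, vonNeumannEntropy (ptraceB (classicalChannelExt W
        (pureState (Pi.single ((0 : Fin 1), k) 1)))) = 0 := fun k => by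
      have : ptraceB (classicalChannelExt W (pureState (Pi.single ((0 : Fin 1), k) 1)))
          = diagonal fun _ => ((1 : ℝ) : ℂ) := by
        ext i j
        obtain rfl := Subsingleton.elim i j
        rw [classicalChannelExt_pureState_single]
        simpa [ptraceB] using congrArg (fun r : ℝ => (r : ℂ)) (hWsum k)
      rw [this, vonNeumannEntropy_diagonal]
      simp
    refine ⟨din, 1, q, fun k => Pi.single (0, k) 1, hq.1, hq.2, fun k => ?_, ?_⟩
    · simp [Pi.single_apply]
    · have hmix := vonNeumannEntropy_sum_smul_ptraceA W q
        fun k => Pi.single ((0 : Fin 1), k) (1 : ℂ)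
      simp only [inputWeight_single, mul_ite, mul_one, mul_zero, Finset.sum_ite_eq,
        Finset.mem_univ, if_true] at hmix
      rw [← hqC, mutualInformation] at h1 h3
      simp only [hmix, hA, hAB, hB, zero_add, sub_self, mul_zero, Finset.sum_const_zero, add_zero]
      exact ⟨h1, h2, h3⟩
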